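/- arXiv:1606.04309 — 3 statements merged into one kernel-verified Lean document; each statement's English description precedes it below -/
import Mathlib

section
/- Let t ≥ 10. Then for all r > 0 and all y, y′ ∈ E with |y−y′| < r it holds that σ(Γ_{tr}(y) Δ Γ_{tr}(y′)) ≤ C(n)/t, where Γ_{tr}(y) Δ Γ_{tr}(y′) := (Γ_{tr}(y) \ Γ_{tr}(y′)) ∪ (Γ_{tr}(y′) \ Γ_{tr}(y)) and C(n) depends only on the dimension n. -/
open MeasureTheory Metric Set ENNReal

noncomputable section

abbrev Rn (n : ℕ) := EuclideanSpace ℝ (Fin n)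

variable {n : ℕ}

/-- The cone Γ(y) = {x ∈ ℝⁿ \ E : |x-y| < 2 d(x,E)}. -/
def coneAt (E : Set (Rn n)) (y : Rn n) : Set (Rn n) :=
  {x | x ∉ E ∧ dist x y < 2 * infDist x E}

/-- The measure σ(A) = ∫_A d(x,E)^{-n} dm_n on ℝⁿ \ E. -/
def sigmaE (E : Set (Rn n)) : Measure (Rn n) :=
  (volume.withDensity fun x => ENNReal.ofReal ((infDist x E ^ n)⁻¹)).restrict Eᶜ

/-- Size condition on the kernel. -/
def KernelSize (E : Set (Rn n)) (S : Rn n → Rn n → ℂ) (m α K₁ : ℝ) : Prop :=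
  ∀ x ∉ E, ∀ y ∈ E, ‖S x y‖ ≤ K₁ * dist x y ^ (-(m + α))

/-- Hölder condition in the second variable. -/
def KernelHolder (E : Set (Rn n)) (S : Rn n → Rn n → ℂ) (m α β K₂ : ℝ) : Prop :=
  ∀ x ∉ E, ∀ y ∈ E, ∀ y' ∈ E, dist y y' ≤ dist x y / 2 →
    ‖S x y - S x y'‖ ≤ K₂ * dist y y' ^ β * dist x y ^ (-(m + α + β))

/-- μ is a measure of order m in E with constant C₀. -/
def OrderM (E : Set (Rn n)) (μ : Measure (Rn n)) (m C₀ : ℝ) : Prop :=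
  μ Eᶜ = 0 ∧ ∀ y ∈ E, ∀ r : ℝ, 0 < r → μ (ball y r) ≤ ENNReal.ofReal (C₀ * r ^ m)

/-- Square function of f (w.r.t. μ and kernel S) with the integration in the cone
variable over a set A: (∫_A |T_μ f(x)|² d(x,E)^{2α} dσ(x))^{1/2}, ℝ≥0∞-valued. -/
def coneSFOn (E : Set (Rn n)) (S : Rn n → Rn n → ℂ) (α : ℝ) (μ : Measure (Rn n))
    (f : Rn n → ℂ) (A : Set (Rn n)) : ℝ≥0∞ :=
  (∫⁻ x in A, (‖∫ z in E, S x z * f z ∂μ‖₊ : ℝ≥0∞) ^ 2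
      * ENNReal.ofReal (infDist x E ^ (2 * α)) ∂(sigmaE E)) ^ (1/2 : ℝ)

/-- Radial maximal function M^m(|f|μ)(y). -/
def radialMax (m : ℝ) (μ : Measure (Rn n)) (f : Rn n → ℂ) (y : Rn n) : ℝ≥0∞ :=
  ⨆ (r : ℝ) (_ : 0 < r), (∫⁻ z in ball y r, (‖f z‖₊ : ℝ≥0∞) ∂μ) / ENNReal.ofReal (r ^ m)

/-- (a,b)-doubling closed ball. -/
def DoublingCB (μ : Measure (Rn n)) (a b : ℝ) (y : Rn n) (r : ℝ) : Prop :=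
  μ (closedBall y (a * r)) ≤ ENNReal.ofReal b * μ (closedBall y r)

/-- κ-small boundary for a (closed) ball. -/
def SmallBoundaryCB (μ : Measure (Rn n)) (κ : ℝ) (y : Rn n) (r : ℝ) : Prop :=
  ∀ s ∈ Icc (0:ℝ) 1,
    μ {x | r * (1 - s) < dist x y ∧ dist x y < r * (1 + s)}
      ≤ ENNReal.ofReal (κ * s) * μ (closedBall y (3 * r))

/-- The points at distance between `R` and `2R` from `E` which lie in the cone at `y` within `r` of
its boundary, and from which moving in direction `v` decreases the distance to `E` at rate at
least `3/4`. -/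
def coneStrip (E : Set (Rn n)) (y : Rn n) (r R : ℝ) (v : Rn n) : Set (Rn n) :=
  {x | 2 * infDist x E - r ≤ dist x y ∧ dist x y < 2 * infDist x E ∧ R ≤ infDist x E ∧
    infDist x E ≤ 2 * R ∧ ∀ h ∈ Icc 0 R, infDist (x + h • v) E ≤ infDist x E - 3 / 4 * h}

theorem measurableSet_coneStrip (E : Set (Rn n)) (y : Rn n) (r R : ℝ) (v : Rn n) :
    MeasurableSet (coneStrip E y r R v) := by
  have hd : Continuous fun x : Rn n => infDist x E := continuous_infDist_pt E
  have hy : Continuous fun x : Rn n => dist x y := by fun_prop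
  refine (measurableSet_le (by fun_prop) hy.measurable).inter <|
    (measurableSet_lt hy.measurable (by fun_prop)).inter <|
    (measurableSet_le measurable_const hd.measurable).inter <|
    (measurableSet_le hd.measurable measurable_const).inter ?_
  have : {x : Rn n | ∀ h ∈ Icc (0 : ℝ) R, infDist (x + h • v) E ≤ infDist x E - 3 / 4 * h} =
      ⋂ h ∈ Icc (0 : ℝ) R, {x | infDist (x + h • v) E ≤ infDist x E - 3 / 4 * h} := by
    ext x
    simp only [mem_ofPred_eq, mem_iInter]
  change MeasurableSet {x : Rn n | ∀ h ∈ Icc (0 : ℝ) R, _}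
  rw [this]
  exact (isClosed_biInter fun h _ =>
    isClosed_le (hd.comp (by fun_prop)) (hd.sub continuous_const)).measurableSet

/-- Translates of a strip by multiples of `v` spaced by `2r` stay disjoint. -/
theorem notMem_coneStrip_add_smul {E : Set (Rn n)} {y v x : Rn n} {r R h : ℝ} (hv : ‖v‖ = 1)
    (hr : 0 < r) (hh : 2 * r ≤ h) (hR : h ≤ R) (hx : x ∈ coneStrip E y r R v) :
    x + h • v ∉ coneStrip E y r R v := by
  rintro ⟨-, h2, -⟩
  obtain ⟨h1, -, -, -, h5⟩ := hx
  have h6 := h5 h ⟨by linarith, hR⟩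
  have h7 : dist x y ≤ dist x (x + h • v) + dist (x + h • v) y := dist_triangle _ _ _
  rw [dist_self_add_right, norm_smul, hv, Real.norm_of_nonneg (by linarith)] at h7
  linarith

theorem volume_coneStrip_le {E : Set (Rn n)} {y v : Rn n} {r R : ℝ} (hv : ‖v‖ = 1)
    (hr : 0 < r) (hR : 10 * r ≤ R) :
    volume (coneStrip E y r R v) ≤
      ENNReal.ofReal (4 * (r / R) * (5 * R) ^ n * (volume (ball (0 : Rn n) 1)).toReal) := by
  have hRpos : 0 < R := by linarith
  set A := coneStrip E y r R v
  set N := ⌊R / (2 * r)⌋₊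
  have hNle : (N : ℝ) * (2 * r) ≤ R := by
    rw [← le_div_iff₀ (by positivity)]
    exact Nat.floor_le (by positivity)
  have hNge : R / (4 * r) ≤ N := by
    have h1 : R / (2 * r) < N + 1 := Nat.lt_floor_add_one _
    rw [div_lt_iff₀ (by positivity)] at h1
    rw [div_le_iff₀ (by positivity)]
    linarith
  let T : Fin N → Set (Rn n) := fun j => (fun x => x + (-(((j : ℕ) : ℝ) * (2 * r)) • v)) ⁻¹' A
  have hTmeas : ∀ j, MeasurableSet (T j) := fun j =>
    (measurableSet_coneStrip E y r R v).preimage (measurable_add_const _)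
  have hjle : ∀ j : Fin N, ((j : ℕ) : ℝ) * (2 * r) ≤ R := fun j =>
    (mul_le_mul_of_nonneg_right (by exact_mod_cast j.2.le) (by positivity)).trans hNle
  have key : ∀ i j : Fin N, i < j → Disjoint (T i) (T j) := by
    intro i j hij
    rw [Set.disjoint_left]
    intro x hxi hxj
    have hij' : ((i : ℕ) : ℝ) + 1 ≤ (j : ℕ) := by exact_mod_cast hij
    have h0 : (0 : ℝ) ≤ (i : ℕ) := by positivity
    replace hxi : x + (-(((i : ℕ) : ℝ) * (2 * r)) • v) ∈ A := hxi
    replace hxj : x + (-(((j : ℕ) : ℝ) * (2 * r)) • v) ∈ A := hxj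
    have hshift : x + (-(((i : ℕ) : ℝ) * (2 * r)) • v) =
        x + (-(((j : ℕ) : ℝ) * (2 * r)) • v) + ((((j : ℕ) : ℝ) - (i : ℕ)) * (2 * r)) • v := by
      module
    rw [hshift] at hxi
    have hgap : 2 * r ≤ (((j : ℕ) : ℝ) - (i : ℕ)) * (2 * r) := by nlinarith
    have hlen : (((j : ℕ) : ℝ) - (i : ℕ)) * (2 * r) ≤ R := by nlinarith [hjle j]
    exact notMem_coneStrip_add_smul hv hr hgap hlen hxj hxi
  have hTdisj : Pairwise (Function.onFun Disjoint T) := by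
    intro i j hij
    rcases lt_or_gt_of_ne hij with h | h
    · exact key i j h
    · exact (key j i h).symm
  have hTsub : (⋃ j, T j) ⊆ ball y (5 * R) := by
    refine iUnion_subset fun j x hx => ?_
    obtain ⟨-, h2, -, h4, -⟩ := hx
    have h5 := dist_triangle x (x + (-(((j : ℕ) : ℝ) * (2 * r)) • v)) y
    rw [dist_self_add_right, norm_smul, hv, norm_neg, Real.norm_of_nonneg (by positivity)] at h5
    rw [mem_ball]
    linarith [hjle j]
  have hsum : (N : ℝ≥0∞) * volume A ≤ volume (ball y (5 * R)) := by
    have h1 := measure_mono (μ := volume) hTsub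
    rw [measure_iUnion hTdisj hTmeas, tsum_fintype] at h1
    simpa [T, measure_preimage_add_right] using h1
  rw [Measure.addHaar_ball_of_pos _ _ (by positivity), finrank_euclideanSpace_fin] at hsum
  have hfin : volume (ball (0 : Rn n) 1) ≠ ∞ := measure_ball_lt_top.ne
  rw [← ENNReal.ofReal_toReal hfin, ← ENNReal.ofReal_mul (by positivity)] at hsum
  calc volume A = ENNReal.ofReal (4 * (r / R)) * (ENNReal.ofReal (R / (4 * r)) * volume A) := by
        rw [← mul_assoc, ← ENNReal.ofReal_mul (by positivity)]
        have : 4 * (r / R) * (R / (4 * r)) = 1 := by field_simp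
        rw [this, ENNReal.ofReal_one, one_mul]
    _ ≤ ENNReal.ofReal (4 * (r / R)) * ((N : ℝ≥0∞) * volume A) := by
        gcongr
        rw [← ENNReal.ofReal_natCast]
        exact ENNReal.ofReal_le_ofReal hNge
    _ ≤ _ := by
        refine (mul_le_mul_right hsum _).trans_eq ?_
        rw [← ENNReal.ofReal_mul (by positivity), mul_assoc (4 * (r / R))]

theorem sigmaE_coneStrip_le {E : Set (Rn n)} {y v : Rn n} {r R : ℝ} (hv : ‖v‖ = 1)
    (hr : 0 < r) (hR : 10 * r ≤ R) :
    sigmaE E (coneStrip E y r R v) ≤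
      ENNReal.ofReal (4 * 5 ^ n * (volume (ball (0 : Rn n) 1)).toReal * (r / R)) := by
  have hRpos : 0 < R := by linarith
  have hmeas := measurableSet_coneStrip E y r R v
  calc sigmaE E (coneStrip E y r R v)
      ≤ ∫⁻ x in coneStrip E y r R v, ENNReal.ofReal ((infDist x E ^ n)⁻¹) := by
        refine (Measure.restrict_apply_le _ _).trans_eq ?_
        exact withDensity_apply _ hmeas
    _ ≤ ∫⁻ _ in coneStrip E y r R v, ENNReal.ofReal ((R ^ n)⁻¹) := by
        refine setLIntegral_mono' hmeas fun x hx => ?_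
        have : R ≤ infDist x E := hx.2.2.1
        gcongr
    _ = ENNReal.ofReal ((R ^ n)⁻¹) * volume (coneStrip E y r R v) := setLIntegral_const _ _
    _ ≤ ENNReal.ofReal ((R ^ n)⁻¹) * _ := mul_le_mul_right (volume_coneStrip_le hv hr hR) _
    _ = _ := by
        rw [← ENNReal.ofReal_mul (by positivity), mul_pow]
        congr 1
        field_simp

/-- The unit sphere is covered by finitely many balls of radius `1/4` centred on it. -/
theorem exists_finset_unit_directions (n : ℕ) :
    ∃ F : Finset (Rn n), (∀ v ∈ F, ‖v‖ = 1) ∧ ∀ u : Rn n, ‖u‖ = 1 → ∃ v ∈ F, ‖u - v‖ ≤ 1 / 4 := by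
  obtain ⟨F, hFs, hFfin, hF⟩ := (isCompact_sphere (0 : Rn n) 1).finite_cover_balls
    (e := 1 / 4) (by norm_num)
  refine ⟨hFfin.toFinset, fun v hv => ?_, fun u hu => ?_⟩
  · simpa using hFs (hFfin.mem_toFinset.1 hv)
  · have := hF (mem_sphere_zero_iff_norm.2 hu)
    simp only [mem_iUnion, exists_prop] at this
    obtain ⟨v, hv, huv⟩ := this
    exact ⟨v, hFfin.mem_toFinset.2 hv, by rw [← dist_eq_norm]; exact (mem_ball.1 huv).le⟩

theorem infDist_add_smul_le {E : Set (Rn n)} {x e u v : Rn n} {h : ℝ} (he : e ∈ E)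
    (hu : ‖u‖ = 1) (heu : e = x + infDist x E • u) (huv : ‖u - v‖ ≤ 1 / 4) (h0 : 0 ≤ h)
    (hle : h ≤ infDist x E) : infDist (x + h • v) E ≤ infDist x E - 3 / 4 * h := by
  calc infDist (x + h • v) E ≤ dist (x + h • v) e := infDist_le_dist_of_mem he
    _ = ‖-(h • (u - v)) - (infDist x E - h) • u‖ := by
        rw [dist_eq_norm]
        congr 1
        rw [heu]
        module
    _ ≤ ‖h • (u - v)‖ + ‖(infDist x E - h) • u‖ := by
        simpa only [norm_neg] using norm_sub_le (-(h • (u - v))) ((infDist x E - h) • u)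
    _ ≤ infDist x E - 3 / 4 * h := by
        rw [norm_smul, norm_smul, hu, Real.norm_of_nonneg h0,
          Real.norm_of_nonneg (sub_nonneg.2 hle)]
        nlinarith

theorem truncatedCone_diff_subset {E : Set (Rn n)} (hE : IsClosed E) {F : Finset (Rn n)}
    (hF : ∀ u : Rn n, ‖u‖ = 1 → ∃ v ∈ F, ‖u - v‖ ≤ 1 / 4) {r s : ℝ} (hs : 0 < s) {y y' : Rn n}
    (hy : y ∈ E) (hyy : dist y y' < r) :
    {x ∈ coneAt E y | s < infDist x E} \ {x ∈ coneAt E y' | s < infDist x E} ⊆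
      ⋃ k : ℕ, ⋃ v ∈ F, coneStrip E y r (2 ^ k * s) v := by
  rintro x ⟨⟨⟨hxE, hxy⟩, hsx⟩, hx'⟩
  have hxy' : 2 * infDist x E ≤ dist x y' := by
    by_contra! hc
    exact hx' ⟨⟨hxE, hc⟩, hsx⟩
  obtain ⟨e, he, hxe⟩ := hE.exists_infDist_eq_dist ⟨y, hy⟩ x
  have hd : 0 < infDist x E := hs.trans hsx
  obtain ⟨k, hk1, hk2⟩ := exists_nat_pow_near ((one_lt_div hs).2 hsx).le one_lt_two
  rw [le_div_iff₀ hs] at hk1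
  rw [div_lt_iff₀ hs, pow_succ'] at hk2
  have hu : ‖(infDist x E)⁻¹ • (e - x)‖ = 1 := by
    rw [norm_smul, ← dist_eq_norm, dist_comm, ← hxe, norm_inv, Real.norm_of_nonneg hd.le,
      inv_mul_cancel₀ hd.ne']
  obtain ⟨v, hvF, huv⟩ := hF _ hu
  have heu : e = x + infDist x E • ((infDist x E)⁻¹ • (e - x)) := by
    rw [smul_inv_smul₀ hd.ne', add_sub_cancel]
  simp only [mem_iUnion, exists_prop]
  refine ⟨k, v, hvF, ?_, hxy, hk1, by linarith, fun h hh =>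
    infDist_add_smul_le he hu heu huv hh.1 (hh.2.trans hk1)⟩
  linarith [dist_triangle x y y']

theorem sigmaE_truncatedCone_diff_le {E : Set (Rn n)} (hE : IsClosed E) {F : Finset (Rn n)}
    (hF1 : ∀ v ∈ F, ‖v‖ = 1) (hF : ∀ u : Rn n, ‖u‖ = 1 → ∃ v ∈ F, ‖u - v‖ ≤ 1 / 4) {t r : ℝ}
    (ht : 10 ≤ t) (hr : 0 < r) {y y' : Rn n} (hy : y ∈ E) (hyy : dist y y' < r) :
    sigmaE E ({x ∈ coneAt E y | t * r < infDist x E} \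
        {x ∈ coneAt E y' | t * r < infDist x E}) ≤
      ENNReal.ofReal (8 * F.card * 5 ^ n * (volume (ball (0 : Rn n) 1)).toReal / t) := by
  have htpos : 0 < t := by linarith
  set c := (volume (ball (0 : Rn n) 1)).toReal with hc
  have hc0 : 0 ≤ c := ENNReal.toReal_nonneg
  have hstrip : ∀ k : ℕ, ∀ v ∈ F, sigmaE E (coneStrip E y r (2 ^ k * (t * r)) v) ≤
      ENNReal.ofReal (4 * 5 ^ n * c / t * (1 / 2) ^ k) := by
    intro k v hv
    have h1 : (1 : ℝ) ≤ 2 ^ k := one_le_pow₀ one_le_two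
    have h2 : 0 < t * r := by positivity
    refine (sigmaE_coneStrip_le (hF1 v hv) hr (by nlinarith)).trans_eq ?_
    congr 1
    rw [one_div, inv_pow, ← hc]
    field_simp
  have hgeo : Summable fun k : ℕ => (F.card : ℝ) * (4 * 5 ^ n * c / t * (1 / 2) ^ k) :=
    (summable_geometric_two.mul_left _).mul_left _
  calc _ ≤ sigmaE E (⋃ k : ℕ, ⋃ v ∈ F, coneStrip E y r (2 ^ k * (t * r)) v) :=
        measure_mono (truncatedCone_diff_subset hE hF (by positivity) hy hyy)
    _ ≤ ∑' k : ℕ, sigmaE E (⋃ v ∈ F, coneStrip E y r (2 ^ k * (t * r)) v) := measure_iUnion_le _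
    _ ≤ ∑' k : ℕ, ENNReal.ofReal (F.card * (4 * 5 ^ n * c / t * (1 / 2) ^ k)) := by
        refine ENNReal.tsum_le_tsum fun k => (measure_biUnion_finset_le _ _).trans ?_
        refine (Finset.sum_le_sum (hstrip k)).trans_eq ?_
        rw [Finset.sum_const, nsmul_eq_mul, ENNReal.ofReal_mul F.card.cast_nonneg,
          ENNReal.ofReal_natCast]
    _ = ENNReal.ofReal (∑' k : ℕ, F.card * (4 * 5 ^ n * c / t * (1 / 2) ^ k)) :=
        (ENNReal.ofReal_tsum_of_nonneg (fun k => by positivity) hgeo).symm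
    _ = _ := by
        rw [tsum_mul_left, tsum_mul_left, tsum_geometric_two]
        congr 1
        ring

/-- σ(Γ_{tr}(y) Δ Γ_{tr}(y′)) ≤ C(n)/t for t ≥ 10, |y−y′| < r. -/
theorem statement8 (n : ℕ) :
    ∃ C > 0, ∀ (E : Set (Rn n)), IsClosed E → ∀ t : ℝ, 10 ≤ t →
      ∀ r : ℝ, 0 < r → ∀ y ∈ E, ∀ y' ∈ E, dist y y' < r →
      sigmaE E
        (({x ∈ coneAt E y | t * r < infDist x E} \ {x ∈ coneAt E y' | t * r < infDist x E}) ∪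
         ({x ∈ coneAt E y' | t * r < infDist x E} \ {x ∈ coneAt E y | t * r < infDist x E}))
        ≤ ENNReal.ofReal (C / t) := by
  obtain ⟨F, hF1, hF⟩ := exists_finset_unit_directions n
  set c := (volume (ball (0 : Rn n) 1)).toReal with hc
  have hc0 : 0 ≤ c := ENNReal.toReal_nonneg
  refine ⟨16 * F.card * 5 ^ n * c + 1, by positivity, ?_⟩
  intro E hE t ht r hr y hy y' hy' hyy
  have htpos : 0 < t := by linarith
  refine (measure_union_le _ _).trans ?_
  refine (add_le_add (sigmaE_truncatedCone_diff_le hE hF1 hF ht hr hy hyy)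
    (sigmaE_truncatedCone_diff_le hE hF1 hF ht hr hy' (by rwa [dist_comm]))).trans ?_
  rw [← ENNReal.ofReal_add (by positivity) (by positivity), ← add_div, ← hc]
  refine ENNReal.ofReal_le_ofReal (div_le_div_of_nonneg_right ?_ htpos.le)
  linarith
end
end

section
/- Let μ be a Borel measure with supp μ ⊂ E, and let U ⊊ E be a relatively open subset of E with μ(U) < ∞. Let a ≥ 3, ρ ≥ 16a, let b be a big enough constant depending on ρ and n, and let κ be a big enough constant depending only on n. Set δ = 1/1000, C₁ := ρ/8 and C₂ := (12+ρ)δ^{−1}/6. Then there exist a constant D₀ = D₀(ρ,n) and a finite collection {B_i}_{i∈I} of closed balls in E with the following properties: (i) B_i ∩ B_j = ∅ if i ≠ j; (ii) for every i ∈ I there are at most D₀ indices j ∈ I with (C₁/2)B_i ∩ (C₁/2)B_j ≠ ∅; (iii) for every i ∈ I, C₁B_i ⊂ U and C₂B_i ∩ (E \ U) ≠ ∅; (iv) each B_i is (a,b)-doubling and has κ-small boundary with respect to μ; (v) μ(⋃_{i∈I} B_i) ≥ μ(U)/(2b). -/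
open MeasureTheory Metric Set ENNReal

noncomputable section

variable {n : ℕ}

/-- Every center admits, at every scale, a radius with small boundary. -/
lemma exists_smallBoundaryCB (μ : Measure (Rn n)) (x : Rn n) {R : ℝ} (hR : 0 < R) :
    ∃ t ∈ Icc R (6 / 5 * R), SmallBoundaryCB μ 100 x t := by
  by_contra hcon
  have H : ∀ t ∈ Icc R (6 / 5 * R), ∃ s ∈ Icc (0 : ℝ) 1,
      ENNReal.ofReal (100 * s) * μ (closedBall x (3 * t)) <
        μ {y | t * (1 - s) < dist y x ∧ dist y x < t * (1 + s)} := by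
    intro t ht
    by_contra h
    refine hcon ⟨t, ht, fun s hs => ?_⟩
    by_contra h2
    exact h ⟨s, hs, not_le.mp h2⟩
  choose! s hs hlt using H
  set T : Set ℝ := Icc R (6 / 5 * R) with hT
  set ann : ℝ → Set (Rn n) :=
    fun t => {y | t * (1 - s t) < dist y x ∧ dist y x < t * (1 + s t)} with hann
  set A := μ (closedBall x (3 * R)) with hA
  have hsub : ∀ t ∈ T, ann t ⊆ closedBall x (3 * R) := by
    intro t ht y hy
    have h1 := (hs t ht).2
    have h2 := hy.2
    rw [mem_closedBall]
    nlinarith [ht.1, ht.2]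
  have hltA : ∀ t ∈ T, ENNReal.ofReal (100 * s t) * A < μ (ann t) := fun t ht =>
    lt_of_le_of_lt (mul_le_mul_right (measure_mono (closedBall_subset_closedBall (by linarith [ht.1]))) _)
      (hlt t ht)
  have hspos : ∀ t ∈ T, 0 < s t := by
    intro t ht
    rcases (hs t ht).1.eq_or_lt with h | h
    · have he : ann t = ∅ := by
        ext y
        simp only [hann, ← h, mem_ofPred_eq, mem_empty_iff_false, iff_false]
        intro hy
        linarith [hy.1, hy.2]
      have := hltA t ht
      simp [he] at this
    · exact h
  have hRT : R ∈ T := ⟨le_rfl, by linarith⟩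
  have hA0 : A ≠ 0 := by
    intro h
    have h1 := hltA R hRT
    have h2 : μ (ann R) ≤ A := measure_mono (hsub R hRT)
    rw [h] at h2
    exact not_lt_bot (lt_of_lt_of_le h1 h2)
  have hAtop : A ≠ ⊤ := by
    intro h
    have h1 := hltA R hRT
    rw [h, ENNReal.mul_top] at h1
    · exact not_top_lt h1
    · have := hspos R hRT
      simp only [ne_eq, ENNReal.ofReal_eq_zero, not_le]
      positivity
  obtain ⟨u, huT, hdisj, hcov⟩ :=
    Vitali.exists_disjoint_subfamily_covering_enlargement_closedBall T (fun t => t)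
      (fun t => t * s t) (6 / 5 * R)
      (fun t ht => by nlinarith [(hs t ht).1, (hs t ht).2, ht.1, ht.2]) 5 (by norm_num)
  have hrpos : ∀ t ∈ T, 0 < t * s t := fun t ht =>
    mul_pos (lt_of_lt_of_le hR ht.1) (hspos t ht)
  have hucount : u.Countable := by
    refine hdisj.countable_of_nonempty_interior fun t ht => ?_
    exact ⟨t, ball_subset_interior_closedBall (mem_ball_self (hrpos t (huT ht)))⟩
  have hsumann : ∑' t : u, μ (ann t) ≤ A := by
    rw [← measure_biUnion hucount]
    · exact measure_mono (iUnion₂_subset fun t ht => hsub t (huT ht))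
    · intro t ht t' ht' hne
      refine Set.disjoint_left.mpr fun y hy hy' => ?_
      have hmem : ∀ τ : ℝ, y ∈ ann τ → dist y x ∈ closedBall τ (τ * s τ) := by
        intro τ h
        rw [mem_closedBall, Real.dist_eq, abs_le]
        constructor <;> nlinarith [h.1, h.2]
      exact Set.disjoint_left.mp (hdisj ht ht' hne) (hmem t hy) (hmem t' hy')
    · intro t _
      exact (measurableSet_lt measurable_const (measurable_id.dist measurable_const)).inter
        (measurableSet_lt (measurable_id.dist measurable_const) measurable_const)
  have hvol : ENNReal.ofReal (R / 5) ≤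
      ∑' t : u, ENNReal.ofReal (12 * R) * ENNReal.ofReal (s t) := by
    calc ENNReal.ofReal (R / 5) = volume T := by
          rw [hT, Real.volume_Icc]; congr 1; ring
      _ ≤ volume (⋃ t ∈ u, closedBall t (5 * (t * s t))) := by
          refine measure_mono fun t ht => ?_
          obtain ⟨t', ht', hss⟩ := hcov t ht
          exact mem_iUnion₂.mpr ⟨t', ht', hss (mem_closedBall_self (hrpos t ht).le)⟩
      _ ≤ ∑' t : u, volume (closedBall (t : ℝ) (5 * (t * s t))) := measure_biUnion_le _ hucount _
      _ ≤ _ := by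
          refine ENNReal.tsum_le_tsum fun t => ?_
          have ht := huT t.2
          rw [Real.volume_closedBall, ← ENNReal.ofReal_mul (by positivity)]
          refine ENNReal.ofReal_le_ofReal ?_
          nlinarith [hspos t ht, ht.2]
  have hfinal : ENNReal.ofReal (20 * R) * A ≤ ENNReal.ofReal (12 * R) * A := by
    calc ENNReal.ofReal (20 * R) * A = ENNReal.ofReal (R / 5) * (ENNReal.ofReal 100 * A) := by
          rw [← mul_assoc, ← ENNReal.ofReal_mul (by positivity)]; congr 2; ring
      _ ≤ (∑' t : u, ENNReal.ofReal (12 * R) * ENNReal.ofReal (s t)) *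
            (ENNReal.ofReal 100 * A) := by gcongr
      _ = ENNReal.ofReal (12 * R) * ∑' t : u, ENNReal.ofReal (100 * s t) * A := by
          rw [ENNReal.tsum_mul_left, mul_assoc, ← ENNReal.tsum_mul_right]
          congr 1
          refine tsum_congr fun t => ?_
          rw [ENNReal.ofReal_mul (by norm_num)]
          ring
      _ ≤ ENNReal.ofReal (12 * R) * ∑' t : u, μ (ann t) := by
          gcongr with t
          exact (hltA t (huT t.2)).le
      _ ≤ _ := by gcongr
  rw [ENNReal.mul_le_mul_iff_left hA0 hAtop, ENNReal.ofReal_le_ofReal_iff (by positivity)] at hfinal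
  linarith

/-- A maximal Whitney-type net for a positive slowly varying scale function. -/
lemma exists_separated_net {X : Type*} [PseudoMetricSpace X] (f : X → ℝ)
    (hf : ∀ x y, f x ≤ f y + dist x y) (G : Set X) (hpos : ∀ x ∈ G, 0 < f x)
    {τ : ℝ} (hτ : 0 < τ) (hτ' : τ ≤ 1 / 3) :
    ∃ S ⊆ G, (S.Pairwise fun z z' => τ * (f z + f z') < dist z z') ∧
      ∀ x ∈ G, ∃ z ∈ S, dist x z ≤ 3 * τ * f z := by
  obtain ⟨S, hS⟩ := zorn_subset
    {S : Set X | S ⊆ G ∧ S.Pairwise fun z z' => τ * (f z + f z') < dist z z'} (by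
      intro c hc hchain
      refine ⟨⋃₀ c, ⟨sUnion_subset fun s hs => (hc hs).1, ?_⟩, fun s => subset_sUnion_of_mem⟩
      exact (Set.pairwise_sUnion hchain.directedOn).mpr fun s hs => (hc hs).2)
  refine ⟨S, hS.prop.1, hS.prop.2, fun x hx => ?_⟩
  by_contra! hcon
  have hxS : x ∉ S := fun h => by
    have := hcon x h
    rw [dist_self] at this
    have := mul_pos hτ (hpos x hx)
    linarith
  refine hxS (hS.le_of_ge (y := insert x S) ⟨insert_subset hx hS.prop.1, ?_⟩
    (subset_insert x S) (mem_insert x S))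
  have key : ∀ z ∈ S, τ * (f x + f z) < dist x z := by
    intro z hz
    have h1 := hcon z hz
    have h2 := hf x z
    nlinarith [hpos z (hS.prop.1 hz), dist_nonneg (x := x) (y := z)]
  refine hS.prop.2.insert fun z hz _ => ⟨key z hz, ?_⟩
  rw [dist_comm, add_comm]
  exact key z hz

lemma card_le_of_separated_scale (f : Rn n → ℝ) (hf : ∀ x y, f x ≤ f y + dist x y)
    {τ : ℝ} (hτ : 0 < τ) (hτ' : τ ≤ 1 / 3) (F : Finset (Rn n)) (hpos : ∀ z ∈ F, 0 < f z)
    (hsep : (F : Set (Rn n)).Pairwise fun z z' => τ * (f z + f z') < dist z z')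
    (x : Rn n) (hx : ∀ z ∈ F, dist x z ≤ f z / 2) :
    (F.card : ℝ) ≤ (3 / τ) ^ n := by
  rcases F.eq_empty_or_nonempty with rfl | ⟨z₀, hz₀⟩
  · simp only [Finset.card_empty, Nat.cast_zero]; positivity
  have hup : ∀ z ∈ F, f z ≤ 2 * f x := fun z hz => by
    have h1 := hf z x
    have h2 := hx z hz
    rw [dist_comm] at h1
    linarith
  have hlow : ∀ z ∈ F, f x ≤ 3 / 2 * f z := fun z hz => by
    have h1 := hf x z
    have h2 := hx z hz
    linarith
  have hR : 0 < f x := by linarith [hup z₀ hz₀, hpos z₀ hz₀]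
  set R := f x with hRdef
  have hr : 0 < τ * (2 / 3 * R) := by positivity
  have hsub : (⋃ z ∈ F, ball z (τ * (2 / 3 * R))) ⊆ ball x (2 * R) := by
    refine iUnion₂_subset fun z hz => ball_subset_ball' ?_
    have h1 := hx z hz
    have h2 := hup z hz
    rw [dist_comm] at h1
    nlinarith
  have hdisj : (F : Set (Rn n)).PairwiseDisjoint fun z => ball z (τ * (2 / 3 * R)) := by
    intro z hz z' hz' hne
    refine ball_disjoint_ball ?_
    have h1 := hsep hz hz' hne
    have h2 := hlow z hz
    have h3 := hlow z' hz'
    nlinarith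
  have hmeas := measure_mono (μ := (volume : Measure (Rn n))) hsub
  rw [measure_biUnion_finset hdisj (fun _ _ => measurableSet_ball)] at hmeas
  simp only [Measure.addHaar_ball_of_pos _ _ hr,
    Measure.addHaar_ball_of_pos _ _ (show 0 < 2 * R by positivity), Finset.sum_const,
    finrank_euclideanSpace_fin, nsmul_eq_mul] at hmeas
  rw [← mul_assoc, ENNReal.mul_le_mul_iff_left (measure_ball_pos _ _ one_pos).ne' measure_ball_lt_top.ne,
    ← ENNReal.ofReal_natCast, ← ENNReal.ofReal_mul (by positivity),
    ENNReal.ofReal_le_ofReal_iff (by positivity)] at hmeas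
  have heq : (2 * R) ^ n = (3 / τ) ^ n * (τ * (2 / 3 * R)) ^ n := by
    rw [← mul_pow]; congr 1; field_simp
  rw [heq] at hmeas
  exact le_of_mul_le_mul_right hmeas (by positivity)

lemma tsum_measure_le_of_bounded_overlap {X ι : Type*} [MeasurableSpace X] [Countable ι]
    (ν : Measure X) (A : ι → Set X) (hA : ∀ i, MeasurableSet (A i)) (M : ℝ)
    (hM : ∀ (x : X) (F : Finset ι), (∀ i ∈ F, x ∈ A i) → (F.card : ℝ) ≤ M) :
    ∑' i, ν (A i) ≤ ENNReal.ofReal M * ν univ := by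
  classical
  calc ∑' i, ν (A i) = ∫⁻ x, ∑' i, (A i).indicator 1 x ∂ν := by
        rw [lintegral_tsum fun i => (measurable_one.indicator (hA i)).aemeasurable]
        exact tsum_congr fun i => (lintegral_indicator_one (hA i)).symm
    _ ≤ ∫⁻ _, ENNReal.ofReal M ∂ν := by
        refine lintegral_mono fun x => ?_
        simp only
        rw [ENNReal.tsum_eq_iSup_sum]
        refine iSup_le fun F => ?_
        have h := hM x (F.filter fun i => x ∈ A i) fun i hi => (Finset.mem_filter.mp hi).2
        simp only [Set.indicator_apply, Pi.one_apply]
        rw [Finset.sum_boole, ← ENNReal.ofReal_natCast]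
        exact ENNReal.ofReal_le_ofReal h
    _ = _ := lintegral_const _

lemma countable_of_separated_scale (f : Rn n → ℝ) {τ : ℝ} (hτ : 0 < τ) (S : Set (Rn n))
    (hpos : ∀ z ∈ S, 0 < f z)
    (hsep : S.Pairwise fun z z' => τ * (f z + f z') < dist z z') : S.Countable := by
  refine Set.PairwiseDisjoint.countable_of_isOpen (s := fun z => ball z (τ * f z)) ?_
    (fun _ _ => isOpen_ball) (fun z hz => nonempty_ball.mpr (mul_pos hτ (hpos z hz)))
  intro z hz z' hz' hne
  exact ball_disjoint_ball (by linarith [hsep hz hz' hne])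

/-- Whitney type lemma with regular balls: balls in E are
B̄_E(y,r) = B̄(y,r) ∩ E, encoded below by center–radius pairs. With δ = 1/1000,
C₁ = ρ/8 and C₂ = (12+ρ)δ⁻¹/6 = (12+ρ)·1000/6. -/
theorem statement10 (n : ℕ) :
    ∃ κ > 0, ∀ a ρ : ℝ, 3 ≤ a → 16 * a ≤ ρ →
      ∃ b₀ D₀ : ℝ, 0 < D₀ ∧
      ∀ b : ℝ, b₀ ≤ b →
      ∀ (E : Set (Rn n)), IsClosed E →
      ∀ (μ : Measure (Rn n)), μ Eᶜ = 0 →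
      ∀ (U : Set (Rn n)), (∃ Vop : Set (Rn n), IsOpen Vop ∧ U = Vop ∩ E) → U ≠ E →
        μ U < ⊤ →
      ∃ I : Finset (Rn n × ℝ),
        -- closed balls in E with centers in E and positive radii
        (∀ q ∈ I, q.1 ∈ E ∧ 0 < q.2) ∧
        -- (i) the balls B_i are pairwise disjoint
        (∀ q ∈ I, ∀ q' ∈ I, q ≠ q' →
          (closedBall q.1 q.2 ∩ E) ∩ (closedBall q'.1 q'.2 ∩ E) = ∅) ∧
        -- (ii) bounded overlap of the balls (C₁/2)B_i
        (∀ q ∈ I, ({q' ∈ (I : Set (Rn n × ℝ)) |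
            ((closedBall q.1 ((ρ/8)/2 * q.2) ∩ E) ∩
              (closedBall q'.1 ((ρ/8)/2 * q'.2) ∩ E)).Nonempty}.ncard : ℝ) ≤ D₀) ∧
        -- (iii) C₁B_i ⊂ U and C₂B_i meets E \ U
        (∀ q ∈ I, closedBall q.1 (ρ/8 * q.2) ∩ E ⊆ U ∧
          ((closedBall q.1 ((12 + ρ) * 1000 / 6 * q.2)) ∩ (E \ U)).Nonempty) ∧
        -- (iv) the balls B_i are (a,b)-doubling and have κ-small boundary
        (∀ q ∈ I, DoublingCB μ a b q.1 q.2 ∧ SmallBoundaryCB μ κ q.1 q.2) ∧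
        -- (v) μ(⋃ B_i) ≥ μ(U)/(2b)
        μ U / ENNReal.ofReal (2 * b) ≤ μ (⋃ q ∈ I, closedBall q.1 q.2 ∩ E) := by
  refine ⟨100, by norm_num, fun a ρ ha hρ => ?_⟩
  have hρ48 : 48 ≤ ρ := by linarith
  set ε : ℝ := 1 / (2 * ρ) with hε
  have hε0 : 0 < ε := by positivity
  have hερ : ε * ρ = 1 / 2 := by rw [hε]; field_simp
  have hεs : ε ≤ 1 / 96 := by nlinarith
  have hεa : ε * a ≤ 1 / 32 := by nlinarith
  set M : ℝ := (3 / (ε / 3)) ^ n with hM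
  have hM1 : 1 ≤ M := one_le_pow₀ (by rw [le_div_iff₀ (by positivity)]; linarith)
  refine ⟨4 * M, M, by positivity, fun b hb E hE μ hμ U hUex hUE hUfin => ?_⟩
  obtain ⟨V, hV, hUV⟩ := hUex
  rcases eq_or_ne (μ U) 0 with hU0 | hU0
  · exact ⟨∅, by simp [hU0]⟩
  have hUsub : U ⊆ E := hUV ▸ inter_subset_right
  have hFcl : IsClosed (E \ U) := by
    have : E \ U = E ∩ Vᶜ := by rw [hUV]; ext y; simp
    rw [this]; exact hE.inter hV.isClosed_compl
  have hFne : (E \ U).Nonempty := by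
    rw [nonempty_iff_ne_empty, ne_eq, sdiff_eq_empty]
    exact fun h => hUE (hUsub.antisymm h)
  set f : Rn n → ℝ := fun x => infDist x (E \ U) with hfdef
  have hf : ∀ x y, f x ≤ f y + dist x y := fun x y => infDist_le_infDist_add_dist
  have hfpos : ∀ x ∈ U, 0 < f x := fun x hx =>
    (hFcl.notMem_iff_infDist_pos hFne).mp fun h => h.2 hx
  have hballU : ∀ z r, r < f z → closedBall z r ∩ E ⊆ U := by
    rintro z r hr y ⟨hy, hyE⟩
    by_contra hyU
    have h1 : f z ≤ dist z y := infDist_le_dist_of_mem ⟨hyE, hyU⟩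
    rw [mem_closedBall, dist_comm] at hy
    linarith
  set good : Set (Rn n) := {x | x ∈ U ∧
    μ (closedBall x (6 / 5 * a * (ε * f x))) ≤
      ENNReal.ofReal (2 * M) * μ (closedBall x (ε * f x))} with hgood
  have hbad : 2 * μ (U \ good) ≤ μ U := by
    obtain ⟨S, hSG, hsep, hcov⟩ := exists_separated_net f hf (U \ good)
      (fun x hx => hfpos x hx.1) (τ := ε / 3) (by positivity) (by linarith)
    have hScount : S.Countable := countable_of_separated_scale f (by positivity : 0 < ε / 3) S
      (fun z hz => hfpos z (hSG hz).1) hsep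
    have := hScount.to_subtype
    have h1 : μ (U \ good) ≤ ∑' z : S, μ (closedBall (z : Rn n) (ε * f z)) := by
      refine (measure_mono fun x hx => ?_).trans
        (measure_biUnion_le μ hScount fun z => closedBall z (ε * f z))
      obtain ⟨z, hz, hxz⟩ := hcov x hx
      refine mem_iUnion₂.mpr ⟨z, hz, ?_⟩
      rw [mem_closedBall]
      linarith
    have h2 : ∑' z : S, (μ.restrict U) (closedBall (z : Rn n) (6 / 5 * a * (ε * f z))) ≤
        ENNReal.ofReal M * (μ.restrict U) univ := by
      refine tsum_measure_le_of_bounded_overlap _ _ (fun _ => measurableSet_closedBall) M ?_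
      intro x F hxF
      have := card_le_of_separated_scale f hf (by positivity : 0 < ε / 3) (by linarith)
        (F.map (Function.Embedding.subtype _)) ?_ ?_ x ?_
      · rwa [Finset.card_map] at this
      · intro z hz
        obtain ⟨w, _, rfl⟩ := Finset.mem_map.mp hz
        exact hfpos _ (hSG w.2).1
      · refine hsep.mono fun z hz => ?_
        obtain ⟨w, _, rfl⟩ := Finset.mem_map.mp hz
        exact w.2
      · intro z hz
        obtain ⟨w, hw, rfl⟩ := Finset.mem_map.mp hz
        have h3 := mem_closedBall.mp (hxF w hw)
        have h4 := hfpos _ (hSG w.2).1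
        simp only [Function.Embedding.subtype_apply]
        nlinarith
    have h3 : ENNReal.ofReal (2 * M) * μ (U \ good) ≤ ENNReal.ofReal M * μ U := by
      calc ENNReal.ofReal (2 * M) * μ (U \ good)
          ≤ ENNReal.ofReal (2 * M) * ∑' z : S, μ (closedBall (z : Rn n) (ε * f z)) := by gcongr
        _ = ∑' z : S, ENNReal.ofReal (2 * M) * μ (closedBall (z : Rn n) (ε * f z)) :=
            ENNReal.tsum_mul_left.symm
        _ ≤ ∑' z : S, (μ.restrict U) (closedBall (z : Rn n) (6 / 5 * a * (ε * f z))) := by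
            refine ENNReal.tsum_le_tsum fun z => ?_
            have hz := hSG z.2
            have hlt : _ < μ (closedBall (z : Rn n) (6 / 5 * a * (ε * f z))) :=
              not_le.mp fun h => hz.2 ⟨hz.1, h⟩
            refine hlt.le.trans ?_
            rw [Measure.restrict_apply measurableSet_closedBall,
              ← measure_inter_conull hμ]
            refine measure_mono fun y hy => ⟨hy.1, hballU z _ ?_ hy⟩
            have h4 := hfpos _ hz.1
            nlinarith
        _ ≤ _ := by simpa using h2
    rw [ENNReal.ofReal_mul (by norm_num), mul_comm (ENNReal.ofReal 2), mul_assoc,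
      ENNReal.mul_le_mul_iff_right (by simp; linarith) ENNReal.ofReal_ne_top] at h3
    simpa using h3
  have hgoodU : μ U ≤ 2 * μ good := by
    have h1 : μ U ≤ μ good + μ (U \ good) := by
      refine (measure_mono fun x hx => ?_).trans (measure_union_le _ _)
      by_cases h : x ∈ good
      exacts [Or.inl h, Or.inr ⟨hx, h⟩]
    have h2 : μ U + μ U ≤ 2 * μ good + μ U := by
      calc μ U + μ U = 2 * μ U := (two_mul _).symm
        _ ≤ 2 * (μ good + μ (U \ good)) := by gcongr
        _ ≤ _ := by rw [mul_add]; gcongr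
    exact (ENNReal.add_le_add_iff_right hUfin.ne).mp h2
  obtain ⟨S, hSG, hsep, hcov⟩ := exists_separated_net f hf good
    (fun x hx => hfpos x hx.1) (τ := 6 / 5 * ε) (by positivity) (by linarith)
  have hSpos : ∀ z ∈ S, 0 < f z := fun z hz => hfpos z (hSG hz).1
  have hScount : S.Countable := countable_of_separated_scale f (by positivity : 0 < 6 / 5 * ε) S
    hSpos hsep
  have hrad : ∀ z ∈ S, ∃ t ∈ Icc (ε * f z) (6 / 5 * (ε * f z)), SmallBoundaryCB μ 100 z t :=
    fun z hz => exists_smallBoundaryCB μ z (mul_pos hε0 (hSpos z hz))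
  choose! t ht htsb using hrad
  have hsum : μ good ≤ ENNReal.ofReal (2 * M) * ∑' z : S, μ (closedBall (z : Rn n) (t z)) := by
    rw [← ENNReal.tsum_mul_left]
    calc μ good ≤ ∑' z : S, μ (closedBall (z : Rn n) (6 / 5 * a * (ε * f z))) := by
          refine (measure_mono fun x hx => ?_).trans
            (measure_biUnion_le μ hScount fun z => closedBall z (6 / 5 * a * (ε * f z)))
          obtain ⟨z, hz, hxz⟩ := hcov x hx
          refine mem_iUnion₂.mpr ⟨z, hz, ?_⟩
          rw [mem_closedBall]
          have := mul_pos hε0 (hSpos z hz)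
          nlinarith
      _ ≤ _ := by
          refine ENNReal.tsum_le_tsum fun z => (hSG z.2).2.trans ?_
          gcongr
          exact (ht z z.2).1
  have hb0 : 0 < b := by linarith
  have hlt : μ U / ENNReal.ofReal (2 * b) < ∑' z : S, μ (closedBall (z : Rn n) (t z)) := by
    rw [ENNReal.div_lt_iff (Or.inl (by simpa using hb0)) (Or.inl ENNReal.ofReal_ne_top)]
    have h1 : μ U ≤ ENNReal.ofReal b * ∑' z : S, μ (closedBall (z : Rn n) (t z)) := by
      calc μ U ≤ 2 * (ENNReal.ofReal (2 * M) * ∑' z : S, μ (closedBall (z : Rn n) (t z))) :=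
            hgoodU.trans (by gcongr)
        _ = ENNReal.ofReal (4 * M) * ∑' z : S, μ (closedBall (z : Rn n) (t z)) := by
            rw [← mul_assoc]
            congr 1
            rw [← ENNReal.ofReal_ofNat, ← ENNReal.ofReal_mul (by norm_num)]
            congr 1; ring
        _ ≤ _ := by gcongr
    calc μ U < μ U + μ U := ENNReal.lt_add_right hUfin.ne hU0
      _ = 2 * μ U := (two_mul _).symm
      _ ≤ 2 * (ENNReal.ofReal b * ∑' z : S, μ (closedBall (z : Rn n) (t z))) := by gcongr
      _ = _ := by
          rw [ENNReal.ofReal_mul (by norm_num), ENNReal.ofReal_ofNat]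
          ring
  rw [ENNReal.tsum_eq_iSup_sum, lt_iSup_iff] at hlt
  obtain ⟨F, hF⟩ := hlt
  have hdisj : S.PairwiseDisjoint fun z => closedBall z (t z) := by
    intro z hz z' hz' hne
    refine closedBall_disjoint_closedBall ?_
    linarith [hsep hz hz' hne, (ht z hz).2, (ht z' hz').2]
  classical
  set I : Finset (Rn n × ℝ) := F.image fun z : S => ((z : Rn n), t z) with hI
  have hImem : ∀ q ∈ I, q.1 ∈ S ∧ q.2 = t q.1 := by
    intro q hq
    obtain ⟨z, _, rfl⟩ := Finset.mem_image.mp hq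
    exact ⟨z.2, rfl⟩
  have hpos : ∀ q ∈ I, 0 < q.2 := fun q hq => by
    rw [(hImem q hq).2]
    exact lt_of_lt_of_le (mul_pos hε0 (hSpos _ (hImem q hq).1)) (ht _ (hImem q hq).1).1
  have hinj : ∀ q ∈ I, ∀ q' ∈ I, q.1 = q'.1 → q = q' := fun q hq q' hq' h =>
    Prod.ext h (by rw [(hImem q hq).2, (hImem q' hq').2, h])
  refine ⟨I, fun q hq => ⟨hUsub (hSG (hImem q hq).1).1, hpos q hq⟩, ?_, ?_, ?_, ?_, ?_⟩
  · intro q hq q' hq' hne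
    obtain ⟨hz, e⟩ := hImem q hq
    obtain ⟨hz', e'⟩ := hImem q' hq'
    rw [e, e', ← disjoint_iff_inter_eq_empty]
    exact (hdisj hz hz' fun h => hne (hinj q hq q' hq' h)).mono inter_subset_left
      inter_subset_left
  · intro q hq
    set N := {q' ∈ (I : Set (Rn n × ℝ)) | ((closedBall q.1 ((ρ/8)/2 * q.2) ∩ E) ∩
              (closedBall q'.1 ((ρ/8)/2 * q'.2) ∩ E)).Nonempty} with hN
    have hNI : N ⊆ I := fun q' h => h.1
    have hNfin : N.Finite := I.finite_toSet.subset hNI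
    rw [ncard_eq_toFinset_card N hNfin, ← Finset.card_image_of_injOn (f := Prod.fst)]
    · have hmem : ∀ z ∈ hNfin.toFinset.image Prod.fst, ∃ q' ∈ N, q'.1 = z := fun z hz => by
        simpa using hz
      refine card_le_of_separated_scale f hf (by positivity : 0 < ε / 3) (by linarith) _
        ?_ ?_ q.1 ?_
      · intro z hz
        obtain ⟨q', hq', rfl⟩ := hmem z hz
        exact hSpos _ (hImem q' (hNI hq')).1
      · intro z hz z' hz' hne
        obtain ⟨q', hq', rfl⟩ := hmem z hz
        obtain ⟨q'', hq'', rfl⟩ := hmem z' hz'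
        have m1 := (hImem q' (hNI hq')).1
        have m2 := (hImem q'' (hNI hq'')).1
        have h1 := hsep m1 m2 hne
        have h2 := mul_pos hε0 (add_pos (hSpos _ m1) (hSpos _ m2))
        nlinarith
      · intro z hz
        obtain ⟨q', hq', rfl⟩ := hmem z hz
        obtain ⟨y, ⟨hy, _⟩, hy', _⟩ := hq'.2
        obtain ⟨m, e⟩ := hImem q hq
        obtain ⟨m', e'⟩ := hImem q' (hNI hq')
        have hscale : ∀ w ∈ S, (ρ / 8) / 2 * t w ≤ 1 / 25 * f w := by
          intro w hw
          have h1 := (ht w hw).2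
          have h2 : ρ * t w ≤ 3 / 5 * f w := by
            calc ρ * t w ≤ ρ * (6 / 5 * (ε * f w)) := by gcongr
              _ = 6 / 5 * (ε * ρ) * f w := by ring
              _ = _ := by rw [hερ]; ring
          linarith [hSpos w hw]
        rw [mem_closedBall, e] at hy
        rw [mem_closedBall, e'] at hy'
        have h1 := hscale _ m
        have h2 := hscale _ m'
        have h3 := dist_triangle_left q.1 q'.1 y
        have h4 := hf q.1 q'.1
        have h5 := hSpos _ m'
        linarith
    · intro q' hq' q'' hq'' h
      simp only [Finite.coe_toFinset] at hq' hq''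
      exact hinj _ (hNI hq') _ (hNI hq'') h
  · intro q hq
    obtain ⟨m, e⟩ := hImem q hq
    have h0 := hSpos _ m
    refine ⟨hballU _ _ ?_, ?_⟩
    · rw [e]
      calc ρ / 8 * t q.1 ≤ ρ / 8 * (6 / 5 * (ε * f q.1)) := by gcongr; exact (ht _ m).2
        _ = 3 / 20 * (ε * ρ) * f q.1 := by ring
        _ < f q.1 := by rw [hερ]; linarith
    · obtain ⟨y, hy, hyd⟩ := hFcl.exists_infDist_eq_dist hFne q.1
      refine ⟨y, ?_, hy⟩
      rw [mem_closedBall, dist_comm, ← hyd, e]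
      calc f q.1 ≤ (12 * ε + ε * ρ) * 1000 / 6 * f q.1 := by rw [hερ]; nlinarith
        _ = (12 + ρ) * 1000 / 6 * (ε * f q.1) := by ring
        _ ≤ _ := by gcongr; exact (ht _ m).1
  · intro q hq
    obtain ⟨m, e⟩ := hImem q hq
    have h1 := ht _ m
    rw [e]
    refine ⟨?_, htsb _ m⟩
    calc μ (closedBall q.1 (a * t q.1)) ≤ μ (closedBall q.1 (6 / 5 * a * (ε * f q.1))) := by
          refine measure_mono (closedBall_subset_closedBall ?_)
          nlinarith [h1.2]
      _ ≤ ENNReal.ofReal (2 * M) * μ (closedBall q.1 (ε * f q.1)) := (hSG m).2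
      _ ≤ _ := by
          gcongr
          · linarith
          · exact h1.1
  · have hEq : (⋃ q ∈ I, closedBall q.1 q.2 ∩ E) = (⋃ z ∈ F, closedBall (z : Rn n) (t z)) ∩ E := by
      simp only [hI, Finset.set_biUnion_finset_image, iUnion₂_inter]
    rw [hEq, measure_inter_conull hμ, measure_biUnion_finset _ fun _ _ => measurableSet_closedBall]
    · exact hF.le
    · intro z _ z' _ hne
      exact hdisj z.2 z'.2 fun h => hne (Subtype.ext h)
end
end

section
/- Suppose μ is a measure of order m in E. Let c ∈ E, ρ > 0, and let b ∈ M(E) be a complex measure with supp b ⊂ B̄(c,ρ) and b(ℝⁿ) = 0. Then for every y ∈ E with |y−c| ≥ 8ρ there holds C b(y) ≤ C′ ρ^β |b|(ℝⁿ) / |y−c|^{m+β}, where C′ depends only on m, α, β, K₂ and the dimension n. -/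
open MeasureTheory Metric Set ENNReal

noncomputable section

variable {n : ℕ}

/-- Pairing a function that stays within `a` of a constant with a unimodular density of mean zero.
No measurability of `h` is required. -/
lemma enorm_integral_mul_le_of_integral_eq_zero {X : Type*} [MeasurableSpace X] {τ : Measure X}
    [IsFiniteMeasure τ] {g h : X → ℂ} {w : ℂ} {a : ℝ} (hg : AEStronglyMeasurable g τ)
    (hh : ∀ᵐ z ∂τ, ‖h z‖ = 1) (h0 : ∫ z, h z ∂τ = 0) (ha : ∀ᵐ z ∂τ, ‖g z - w‖ ≤ a) :
    ‖∫ z, g z * h z ∂τ‖ₑ ≤ ENNReal.ofReal (2 * a) * τ univ := by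
  have key : ∀ v : ℂ, (∀ᵐ z ∂τ, ‖g z - v‖ ≤ 2 * a) →
      ‖∫ z, (g z - v) * h z ∂τ‖ₑ ≤ ENNReal.ofReal (2 * a) * τ univ := by
    intro v hv
    refine (enorm_integral_le_lintegral_enorm _).trans ?_
    rw [← lintegral_const]
    refine lintegral_mono_ae ?_
    filter_upwards [hv, hh] with z hz hz'
    rw [enorm_mul, ← ofReal_norm (h z), hz', ENNReal.ofReal_one, mul_one, ← ofReal_norm]
    exact ENNReal.ofReal_le_ofReal hz
  by_cases hint : Integrable (fun z => g z * h z) τ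
  swap
  · simp [integral_undef hint]
  by_cases hmeas : AEStronglyMeasurable h τ
  · have hhint : Integrable h τ :=
      Integrable.of_bound hmeas 1 (hh.mono fun z hz => hz.le)
    have : ∫ z, (g z - w) * h z ∂τ = ∫ z, g z * h z ∂τ := by
      simp_rw [sub_mul]
      rw [integral_sub hint (hhint.const_mul w), integral_const_mul, h0]
      simp
    rw [← this]
    refine key w (ha.mono fun z hz => ?_)
    linarith [norm_nonneg (g z - w)]
  · have hzero : ¬ ∀ᵐ z ∂τ, g z ≠ 0 := by
      intro hne
      apply hmeas
      have : AEMeasurable (fun z => g z * h z / g z) τ :=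
        hint.aestronglyMeasurable.aemeasurable.div hg.aemeasurable
      refine (this.congr ?_).aestronglyMeasurable
      filter_upwards [hne] with z hz
      field_simp
    have hfreq : ∃ᵐ z ∂τ, g z = 0 := hzero
    obtain ⟨z₀, hz₀, hz₀'⟩ := (hfreq.and_eventually ha).exists
    have hw : ‖w‖ ≤ a := by simpa [hz₀] using hz₀'
    have := key 0 (ha.mono fun z hz => ?_)
    · simpa using this
    · have := norm_add_le (g z - w) w
      simp only [sub_add_cancel, sub_zero] at this ⊢
      linarith

lemma KernelHolder.continuousOn {E : Set (Rn n)} {S : Rn n → Rn n → ℂ} {m α β K₂ : ℝ}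
    (hS : KernelHolder E S m α β K₂) (hβ : 0 < β) {x : Rn n} (hx : x ∉ E) :
    ContinuousOn (S x) E := by
  intro y hy
  have hxy : 0 < dist x y := dist_pos.2 fun h => hx (h ▸ hy)
  rw [ContinuousWithinAt, tendsto_iff_norm_sub_tendsto_zero]
  have hlim : Filter.Tendsto (fun z => K₂ * dist y z ^ β * dist x y ^ (-(m + α + β)))
      (nhdsWithin y E) (nhds 0) := by
    have hc : Continuous fun z => K₂ * dist y z ^ β * dist x y ^ (-(m + α + β)) := by
      have : Continuous fun z => dist y z ^ β :=
        (continuous_const.dist continuous_id).rpow_const fun _ => Or.inr hβ.le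
      fun_prop
    have := (hc.tendsto y).mono_left (nhdsWithin_le_nhds (s := E))
    simpa [Real.zero_rpow hβ.ne'] using this
  refine squeeze_zero' (Filter.Eventually.of_forall fun _ => norm_nonneg _) ?_ hlim
  filter_upwards [self_mem_nhdsWithin,
    nhdsWithin_le_nhds (closedBall_mem_nhds y (half_pos hxy))] with z hz hz'
  rw [norm_sub_rev]
  refine hS x hx y hy z hz ?_
  rw [dist_comm y z]
  exact hz'

lemma integrable_norm_rpow_mul_one_add_norm_rpow {α γ : ℝ} (hα : 0 < α) (hγ : α < γ) :
    Integrable fun x : Rn n => ‖x‖ ^ (2 * α - n) * (1 + ‖x‖) ^ (-(2 * γ)) := by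
  rcases subsingleton_or_nontrivial (Rn n) with hsub | hnt
  · exact Integrable.of_finite
  have hn : 1 ≤ n := by
    have := Module.finrank_pos (R := ℝ) (M := Rn n)
    simpa [Nat.one_le_iff_ne_zero, Nat.pos_iff_ne_zero] using this
  rw [integrable_fun_norm_addHaar volume
    (f := fun r : ℝ => r ^ (2 * α - n) * (1 + r) ^ (-(2 * γ)))]
  have heq : ∀ r ∈ Ioi (0 : ℝ),
      r ^ (2 * α - 1) * (1 + r) ^ (-(2 * γ)) = r ^ (Module.finrank ℝ (Rn n) - 1) •
        (r ^ (2 * α - n) * (1 + r) ^ (-(2 * γ))) := by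
    intro r hr
    rw [finrank_euclideanSpace_fin, smul_eq_mul, ← mul_assoc, ← Real.rpow_natCast,
      ← Real.rpow_add hr, Nat.cast_sub hn]
    congr 2
    push_cast
    ring
  refine IntegrableOn.congr_fun ?_ heq measurableSet_Ioi
  have hmeas : Measurable fun r : ℝ => r ^ (2 * α - 1) * (1 + r) ^ (-(2 * γ)) := by fun_prop
  rw [← Ioc_union_Ioi_eq_Ioi zero_le_one]
  refine IntegrableOn.union ?_ ?_
  · have h1 : IntegrableOn (fun r : ℝ => r ^ (2 * α - 1)) (Ioc 0 1) := by
      rw [← intervalIntegrable_iff_integrableOn_Ioc_of_le zero_le_one]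
      exact intervalIntegral.intervalIntegrable_rpow' (by linarith)
    refine h1.mono' hmeas.aestronglyMeasurable ?_
    filter_upwards [ae_restrict_mem measurableSet_Ioc] with r hr
    have hr0 := hr.1
    rw [Real.norm_of_nonneg (by positivity)]
    refine mul_le_of_le_one_right (by positivity) ?_
    exact Real.rpow_le_one_of_one_le_of_nonpos (by linarith) (by linarith)
  · have h1 : IntegrableOn (fun r : ℝ => r ^ (2 * α - 1 - 2 * γ)) (Ioi 1) :=
      integrableOn_Ioi_rpow_of_lt (by linarith) one_pos
    refine h1.mono' hmeas.aestronglyMeasurable ?_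
    filter_upwards [ae_restrict_mem measurableSet_Ioi] with r hr
    have hr0 : 0 < r := one_pos.trans hr
    rw [Real.norm_of_nonneg (by positivity), sub_eq_add_neg _ (2 * γ), Real.rpow_add hr0]
    gcongr ?_ * ?_
    exact Real.rpow_le_rpow_of_nonpos hr0 (by linarith) (by linarith)

lemma lintegral_dist_rpow_mul_add_dist_rpow {α γ D : ℝ} (hα : 0 < α) (hγ : α < γ) (hD : 0 < D)
    (y : Rn n) :
    ∫⁻ x, ENNReal.ofReal (dist x y ^ (2 * α - n) * (D + dist x y) ^ (-(2 * γ))) =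
      ENNReal.ofReal (D ^ (2 * α - 2 * γ) *
        ∫ x : Rn n, ‖x‖ ^ (2 * α - n) * (1 + ‖x‖) ^ (-(2 * γ))) := by
  set f : Rn n → ℝ := fun x => ‖x‖ ^ (2 * α - n) * (1 + ‖x‖) ^ (-(2 * γ)) with hf
  have hint : Integrable f := integrable_norm_rpow_mul_one_add_norm_rpow hα hγ
  have hscale : ∀ x : Rn n, dist x y ^ (2 * α - n) * (D + dist x y) ^ (-(2 * γ)) =
      D ^ (2 * α - n - 2 * γ) * f (D⁻¹ • (x - y)) := by
    intro x
    have hx : dist x y = D * ‖D⁻¹ • (x - y)‖ := by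
      rw [norm_smul, Real.norm_of_nonneg (by positivity), dist_eq_norm]
      field_simp
    have hx' : D + dist x y = D * (1 + ‖D⁻¹ • (x - y)‖) := by rw [hx]; ring
    rw [hx', hx, Real.mul_rpow hD.le (norm_nonneg _), Real.mul_rpow hD.le (by positivity),
      sub_eq_add_neg (2 * α - n) (2 * γ), Real.rpow_add hD]
    ring
  simp_rw [hscale]
  rw [← ofReal_integral_eq_lintegral_ofReal]
  · rw [integral_const_mul, integral_sub_right_eq_self (fun x => f (D⁻¹ • x)) y,
      Measure.integral_comp_inv_smul_of_nonneg _ _ hD.le, finrank_euclideanSpace_fin, smul_eq_mul,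
      ← mul_assoc, ← Real.rpow_natCast, ← Real.rpow_add hD]
    congr 3
    ring
  · exact ((hint.comp_smul (inv_ne_zero hD.ne')).comp_sub_right y).const_mul _
  · exact Filter.Eventually.of_forall fun x => by positivity

lemma infDist_pos_of_mem_coneAt {E : Set (Rn n)} {y x : Rn n} (hx : x ∈ coneAt E y) :
    0 < infDist x E := by
  linarith [hx.2, dist_nonneg (x := x) (y := y)]

/-- On the cone at `y`, the distance to another point `c` of `E` is comparable from below with
`dist y c + dist x y`. -/
lemma add_dist_le_of_mem_coneAt {E : Set (Rn n)} {y c x : Rn n} (hc : c ∈ E)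
    (hx : x ∈ coneAt E y) : dist y c + dist x y ≤ 6 * dist x c := by
  have h1 := infDist_le_dist_of_mem hc (x := x)
  have h2 := dist_triangle y x c
  rw [dist_comm y x] at h2
  linarith [hx.2, infDist_nonneg (x := x) (s := E)]

lemma third_dist_le_of_mem_coneAt {E : Set (Rn n)} {y c x : Rn n} (hc : c ∈ E)
    (hx : x ∈ coneAt E y) : dist y c ≤ 3 * dist x c := by
  have h1 := infDist_le_dist_of_mem hc (x := x)
  have h2 := dist_triangle y x c
  rw [dist_comm y x] at h2
  linarith [hx.2, infDist_nonneg (x := x) (s := E)]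

lemma coneAt_integrand_le {E : Set (Rn n)} {y c x : Rn n} {α γ : ℝ} (hα : 0 < α) (hγ : 0 < γ)
    (hc : c ∈ E) (hy : y ∈ E) (hx : x ∈ coneAt E y) :
    (infDist x E ^ n)⁻¹ * (dist x c ^ (-(2 * γ)) * infDist x E ^ (2 * α)) ≤
      6 ^ (2 * γ) * 2 ^ n *
        (dist x y ^ (2 * α - n) * (dist y c + dist x y) ^ (-(2 * γ))) := by
  have hd := infDist_pos_of_mem_coneAt hx
  have hxy : 0 < dist x y := dist_pos.2 fun h => hx.1 (h ▸ hy)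
  have h6 := add_dist_le_of_mem_coneAt hc hx
  have hs : 0 < dist y c + dist x y := by positivity
  have h1 : (infDist x E ^ n)⁻¹ ≤ 2 ^ n * dist x y ^ (-(n : ℝ)) := by
    rw [Real.rpow_neg hxy.le, Real.rpow_natCast, ← div_eq_mul_inv, ← div_pow, ← inv_pow]
    refine pow_le_pow_left₀ (by positivity) ?_ n
    rw [inv_le_comm₀ hd (by positivity), inv_div]
    linarith [hx.2]
  have h2 : infDist x E ^ (2 * α) ≤ dist x y ^ (2 * α) :=
    Real.rpow_le_rpow hd.le (infDist_le_dist_of_mem hy) (by positivity)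
  have h3 : dist x c ^ (-(2 * γ)) ≤ 6 ^ (2 * γ) * (dist y c + dist x y) ^ (-(2 * γ)) := by
    have : dist x c ^ (-(2 * γ)) ≤ ((dist y c + dist x y) / 6) ^ (-(2 * γ)) :=
      Real.rpow_le_rpow_of_nonpos (by positivity) (by linarith) (by linarith)
    refine this.trans_eq ?_
    rw [Real.div_rpow hs.le (by norm_num), Real.rpow_neg (by norm_num : (0:ℝ) ≤ 6), div_inv_eq_mul,
      mul_comm]
  calc (infDist x E ^ n)⁻¹ * (dist x c ^ (-(2 * γ)) * infDist x E ^ (2 * α))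
      ≤ (2 ^ n * dist x y ^ (-(n : ℝ))) *
        ((6 ^ (2 * γ) * (dist y c + dist x y) ^ (-(2 * γ))) * dist x y ^ (2 * α)) := by
        gcongr
    _ = _ := by
        rw [sub_eq_add_neg, Real.rpow_add hxy]
        ring

lemma measurableSet_coneAt {E : Set (Rn n)} (hE : IsClosed E) (y : Rn n) :
    MeasurableSet (coneAt E y) :=
  hE.measurableSet.compl.inter
    (measurableSet_lt (measurable_id.dist measurable_const)
      ((continuous_infDist_pt E).measurable.const_mul 2))

lemma setLIntegral_coneAt_sigmaE {E : Set (Rn n)} (hE : IsClosed E) (y : Rn n)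
    {G : Rn n → ℝ≥0∞} (hG : Measurable G) :
    ∫⁻ x in coneAt E y, G x ∂(sigmaE E) =
      ∫⁻ x in coneAt E y, ENNReal.ofReal ((infDist x E ^ n)⁻¹) * G x := by
  have hsub : coneAt E y ∩ Eᶜ = coneAt E y := inter_eq_left.2 fun x hx => hx.1
  have hm : Measurable fun x => ENNReal.ofReal ((infDist x E ^ n)⁻¹) :=
    (((continuous_infDist_pt E).measurable.pow_const n).inv).ennreal_ofReal
  rw [sigmaE, Measure.restrict_restrict (measurableSet_coneAt hE y), hsub,
    restrict_withDensity (measurableSet_coneAt hE y), lintegral_withDensity_eq_lintegral_mul _ hm hG]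
  rfl

lemma setLIntegral_coneAt_le {E : Set (Rn n)} (hE : IsClosed E) {y c : Rn n} {α γ : ℝ}
    (hα : 0 < α) (hγ : α < γ) (hc : c ∈ E) (hy : y ∈ E) (hyc : 0 < dist y c) :
    ∫⁻ x in coneAt E y, ENNReal.ofReal (dist x c ^ (-(2 * γ)) * infDist x E ^ (2 * α))
        ∂(sigmaE E) ≤
      ENNReal.ofReal (6 ^ (2 * γ) * 2 ^ n * (dist y c ^ (2 * α - 2 * γ) *
        ∫ x : Rn n, ‖x‖ ^ (2 * α - n) * (1 + ‖x‖) ^ (-(2 * γ)))) := by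
  have hm : Measurable fun x => infDist x E := (continuous_infDist_pt E).measurable
  rw [setLIntegral_coneAt_sigmaE hE y (by fun_prop)]
  calc _ ≤ ∫⁻ x in coneAt E y, ENNReal.ofReal (6 ^ (2 * γ) * 2 ^ n) *
        ENNReal.ofReal (dist x y ^ (2 * α - n) * (dist y c + dist x y) ^ (-(2 * γ))) := by
        refine setLIntegral_mono' (measurableSet_coneAt hE y) fun x hx => ?_
        have hd := infDist_pos_of_mem_coneAt hx
        rw [← ENNReal.ofReal_mul (by positivity), ← ENNReal.ofReal_mul (by positivity)]
        exact ENNReal.ofReal_le_ofReal (coneAt_integrand_le hα (hα.trans hγ) hc hy hx)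
    _ ≤ ∫⁻ x, ENNReal.ofReal (6 ^ (2 * γ) * 2 ^ n) *
        ENNReal.ofReal (dist x y ^ (2 * α - n) * (dist y c + dist x y) ^ (-(2 * γ))) :=
        setLIntegral_le_lintegral _ _
    _ = _ := by
        rw [lintegral_const_mul _ (by fun_prop), lintegral_dist_rpow_mul_add_dist_rpow hα hγ hyc,
          ← ENNReal.ofReal_mul (by positivity)]

lemma enorm_setIntegral_kernel_le {E : Set (Rn n)} (hE : IsClosed E) {S : Rn n → Rn n → ℂ}
    {m α β K₂ : ℝ} (hK₂ : 0 < K₂) (hβ : 0 < β) (hS : KernelHolder E S m α β K₂)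
    {τ : Measure (Rn n)} [IsFiniteMeasure τ] (hτE : τ Eᶜ = 0) {h : Rn n → ℂ}
    (hh : ∀ᵐ z ∂τ, ‖h z‖ = 1) {c : Rn n} (hc : c ∈ E) {R : ℝ}
    (hτR : τ (closedBall c R)ᶜ = 0) (h0 : ∫ z, h z ∂τ = 0) {x : Rn n} (hx : x ∉ E)
    (hxc : R ≤ dist x c / 2) :
    ‖∫ z in E, S x z * h z ∂τ‖ₑ ≤
      ENNReal.ofReal (2 * (K₂ * R ^ β * dist x c ^ (-(m + α + β)))) * τ univ := by
  have hres : τ.restrict E = τ := Measure.restrict_eq_self_of_ae_mem hτE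
  rw [hres]
  refine enorm_integral_mul_le_of_integral_eq_zero (w := S x c) ?_ hh h0 ?_
  · rw [← hres]
    exact (hS.continuousOn hβ hx).aestronglyMeasurable hE.measurableSet
  · have hE' : ∀ᵐ z ∂τ, z ∈ E := hτE
    have hR' : ∀ᵐ z ∂τ, z ∈ closedBall c R := hτR
    filter_upwards [hE', hR'] with z hz hzR
    rw [mem_closedBall'] at hzR
    rw [norm_sub_rev]
    refine (hS x hx c hc z hz (hzR.trans hxc)).trans ?_
    gcongr

lemma kernel_sq_mul_le_of_mem_coneAt {E : Set (Rn n)} (hE : IsClosed E) {S : Rn n → Rn n → ℂ}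
    {m α β K₂ : ℝ} (hK₂ : 0 < K₂) (hβ : 0 < β) (hS : KernelHolder E S m α β K₂)
    {τ : Measure (Rn n)} [IsFiniteMeasure τ] (hτE : τ Eᶜ = 0) {h : Rn n → ℂ}
    (hh : ∀ᵐ z ∂τ, ‖h z‖ = 1) {c : Rn n} (hc : c ∈ E) {R : ℝ} (hR : 0 < R)
    (hτR : τ (closedBall c R)ᶜ = 0) (h0 : ∫ z, h z ∂τ = 0) {y : Rn n} (hyR : 8 * R ≤ dist y c)
    {x : Rn n} (hx : x ∈ coneAt E y) :
    (‖∫ z in E, S x z * h z ∂τ‖₊ : ℝ≥0∞) ^ 2 * ENNReal.ofReal (infDist x E ^ (2 * α)) ≤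
      (ENNReal.ofReal (2 * K₂ * R ^ β) * τ univ) ^ 2 *
        ENNReal.ofReal (dist x c ^ (-(2 * (m + α + β))) * infDist x E ^ (2 * α)) := by
  have h3 := third_dist_le_of_mem_coneAt hc hx
  have hb := enorm_setIntegral_kernel_le hE hK₂ hβ hS hτE hh hc hτR h0 hx.1 (by linarith)
  have hxc : 0 < dist x c := by linarith
  have hsplit : ENNReal.ofReal (2 * (K₂ * R ^ β * dist x c ^ (-(m + α + β)))) * τ univ =
      ENNReal.ofReal (2 * K₂ * R ^ β) * τ univ *
        ENNReal.ofReal (dist x c ^ (-(m + α + β))) := by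
    rw [mul_right_comm (ENNReal.ofReal _), ← ENNReal.ofReal_mul (by positivity)]
    congr 2
    ring
  have hsq : (dist x c ^ (-(m + α + β))) ^ 2 = dist x c ^ (-(2 * (m + α + β))) := by
    rw [← Real.rpow_natCast, ← Real.rpow_mul hxc.le]
    congr 1
    push_cast
    ring
  rw [hsplit] at hb
  rw [ENNReal.ofReal_mul (p := dist x c ^ _) (by positivity), ← mul_assoc, ← hsq,
    ENNReal.ofReal_pow (by positivity), ← mul_pow]
  gcongr
  exact hb

lemma setLIntegral_coneAt_le_sq {E : Set (Rn n)} (hE : IsClosed E) {y c : Rn n} {m α β Q : ℝ}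
    (hα : 0 < α) (hmβ : 0 < m + β) (hc : c ∈ E) (hy : y ∈ E) (hyc : 0 < dist y c) (hQ0 : 0 ≤ Q)
    (hQ : 6 ^ (2 * (m + α + β)) * 2 ^ n *
      ∫ x : Rn n, ‖x‖ ^ (2 * α - n) * (1 + ‖x‖) ^ (-(2 * (m + α + β))) ≤ Q) :
    ∫⁻ x in coneAt E y,
        ENNReal.ofReal (dist x c ^ (-(2 * (m + α + β))) * infDist x E ^ (2 * α)) ∂(sigmaE E) ≤
      ENNReal.ofReal (√Q / dist y c ^ (m + β)) ^ 2 := by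
  rw [← ENNReal.ofReal_pow (by positivity)]
  refine (setLIntegral_coneAt_le hE hα (by linarith) hc hy hyc).trans
    (ENNReal.ofReal_le_ofReal ?_)
  have hpow : dist y c ^ (2 * α - 2 * (m + α + β)) = ((dist y c ^ (m + β)) ^ 2)⁻¹ := by
    rw [← Real.rpow_natCast, ← Real.rpow_mul hyc.le, ← Real.rpow_neg hyc.le]
    congr 1
    push_cast
    ring
  rw [div_pow, Real.sq_sqrt hQ0, hpow, div_eq_mul_inv, mul_left_comm, mul_comm Q]
  gcongr

/-- if b ∈ M(E) is supported in B̄(c,R) with b(ℝⁿ) = 0, then for y ∈ E with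
|y−c| ≥ 8R one has Cb(y) ≤ C′ R^β |b|(ℝⁿ)/|y−c|^{m+β}, C′ = C′(m,α,β,K₂,n). The complex
measure b is encoded by its polar decomposition b = h·τ with τ = |b| finite, ‖h‖ = 1
τ-a.e. -/
theorem statement19 (n : ℕ) (m α β K₂ : ℝ) (hm : 0 < m) (hα : α ∈ Set.Ioc (0:ℝ) 1)
    (hβ : β ∈ Set.Ioc (0:ℝ) 1) (hK₂ : 0 < K₂) :
    ∃ C' > 0, ∀ (E : Set (Rn n)), IsClosed E →
      ∀ (S : Rn n → Rn n → ℂ) (K₁ : ℝ), KernelSize E S m α K₁ →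
        KernelHolder E S m α β K₂ →
      ∀ (μ : Measure (Rn n)) (C₀ : ℝ), OrderM E μ m C₀ →
      ∀ (τ : Measure (Rn n)), IsFiniteMeasure τ → τ Eᶜ = 0 →
      ∀ h : Rn n → ℂ, (∀ᵐ z ∂τ, ‖h z‖ = 1) →
      ∀ c ∈ E, ∀ R : ℝ, 0 < R → τ (closedBall c R)ᶜ = 0 →
      (∫ z, h z ∂τ) = 0 →
      ∀ y ∈ E, 8 * R ≤ dist y c →
        coneSFOn E S α τ h (coneAt E y)
          ≤ ENNReal.ofReal (C' * R ^ β / dist y c ^ (m + β)) * τ Set.univ := by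
  obtain ⟨hα0, -⟩ := hα
  obtain ⟨hβ0, -⟩ := hβ
  set I : ℝ := ∫ x : Rn n, ‖x‖ ^ (2 * α - n) * (1 + ‖x‖) ^ (-(2 * (m + α + β))) with hI
  have hI0 : 0 ≤ I := integral_nonneg fun x => by positivity
  set Q : ℝ := 6 ^ (2 * (m + α + β)) * 2 ^ n * I + 1 with hQ
  have hQ0 : 0 < Q := by positivity
  refine ⟨2 * K₂ * √Q, by positivity, ?_⟩
  intro E hE S K₁ _ hS μ C₀ _ τ hτ hτE h hh c hc R hR hτR h0 y hy hyR
  have hD : 0 < dist y c := by linarith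
  have hm' : Measurable fun x => infDist x E := (continuous_infDist_pt E).measurable
  have hint : ∫⁻ x in coneAt E y, (‖∫ z in E, S x z * h z ∂τ‖₊ : ℝ≥0∞) ^ 2
      * ENNReal.ofReal (infDist x E ^ (2 * α)) ∂(sigmaE E) ≤
      (ENNReal.ofReal (2 * K₂ * R ^ β) * τ univ) ^ 2 *
        ENNReal.ofReal (√Q / dist y c ^ (m + β)) ^ 2 := by
    refine (setLIntegral_mono' (measurableSet_coneAt hE y) fun x hx =>
      kernel_sq_mul_le_of_mem_coneAt hE hK₂ hβ0 hS hτE hh hc hR hτR h0 hyR hx).trans ?_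
    rw [lintegral_const_mul _ (by fun_prop)]
    gcongr
    exact setLIntegral_coneAt_le_sq hE hα0 (by linarith) hc hy hD hQ0.le (by linarith)
  have hconst : ENNReal.ofReal (2 * K₂ * √Q * R ^ β / dist y c ^ (m + β)) * τ univ =
      ENNReal.ofReal (2 * K₂ * R ^ β) * τ univ * ENNReal.ofReal (√Q / dist y c ^ (m + β)) := by
    rw [mul_right_comm (ENNReal.ofReal _), ← ENNReal.ofReal_mul (by positivity)]
    congr 2
    ring
  rw [coneSFOn, hconst]
  refine (ENNReal.rpow_le_rpow hint (by norm_num)).trans_eq ?_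
  rw [← mul_pow, ← ENNReal.rpow_natCast, ← ENNReal.rpow_mul]
  norm_num
end
end
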